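/- arXiv:2106.13561 — 4 statements merged into one kernel-verified Lean document; each statement's English description precedes it below -/
import Mathlib

section
/- Let a : [0,1] → ℝ be continuous with a(0) = 0. Then there exist constants c₁ > 0 and h₀ ∈ (0,1] such that for every h ∈ (0, h₀] and every c ∈ ℝ one has ∫₀^h (1 + a(x) − c·x)² dx ≥ c₁ · h. -/
/-- The squared `L²` distance on `[0, h]` from the constant `1` to the linear functions
vanishing at the origin is at least `h / 4`. -/
theorem div_four_le_integral_one_sub_mul_sq {h : ℝ} (hh : 0 ≤ h) (c : ℝ) :
    h / 4 ≤ ∫ x in (0 : ℝ)..h, (1 - c * x) ^ 2 := by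
  have key : ∫ x in (0 : ℝ)..h, (1 - c * x) ^ 2 = h - c * h ^ 2 + c ^ 2 * h ^ 3 / 3 := by
    rw [intervalIntegral.integral_eq_sub_of_hasDerivAt
      (f := fun x => x - c * x ^ 2 + c ^ 2 * x ^ 3 / 3)]
    · ring
    · intro x _
      have hd := ((hasDerivAt_id' x).sub (((hasDerivAt_id' x).pow 2).const_mul c)).add
        ((((hasDerivAt_id' x).pow 3).const_mul (c ^ 2)).div_const 3)
      refine HasDerivAt.congr_deriv hd ?_
      norm_num
      ring
    · exact Continuous.intervalIntegrable (by fun_prop) _ _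
  rw [key]
  nlinarith [mul_nonneg hh (sq_nonneg (2 * (c * h) - 3))]

/-- Lower bound for the L² approximation of `1 + a` by linear functions
vanishing at the origin, where `a` is continuous with `a 0 = 0`: there are
`c₁ > 0` and `h₀ ∈ (0,1]` with `∫₀^h (1 + a(x) - c x)² dx ≥ c₁ h` for all
`h ∈ (0, h₀]` and all slopes `c`. -/
theorem stmt_9 (a : ℝ → ℝ) (ha : ContinuousOn a (Set.Icc 0 1)) (ha0 : a 0 = 0) :
    ∃ c₁ : ℝ, 0 < c₁ ∧ ∃ h₀ : ℝ, h₀ ∈ Set.Ioc (0 : ℝ) 1 ∧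
      ∀ h : ℝ, h ∈ Set.Ioc (0 : ℝ) h₀ → ∀ c : ℝ,
        c₁ * h ≤ ∫ x in (0 : ℝ)..h, (1 + a x - c * x) ^ 2 := by
  have hcont := ha 0 (by simp)
  rw [Metric.continuousWithinAt_iff] at hcont
  obtain ⟨δ, hδ, hsmall⟩ := hcont (1 / 4) (by norm_num)
  refine ⟨1 / 16, by norm_num, min (δ / 2) 1, ⟨by positivity, min_le_right _ _⟩, ?_⟩
  rintro h ⟨hpos, hle⟩ c
  have hle_half : h ≤ δ / 2 := hle.trans (min_le_left _ _)
  have hle_one : h ≤ 1 := hle.trans (min_le_right _ _)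
  have hsub : Set.uIcc 0 h ⊆ Set.Icc 0 1 := by
    rw [Set.uIcc_of_le hpos.le]
    exact Set.Icc_subset_Icc_right hle_one
  have hint : IntervalIntegrable (fun x => (1 + a x - c * x) ^ 2) MeasureTheory.volume 0 h := by
    have ha' := ha.mono hsub
    exact ContinuousOn.intervalIntegrable (by fun_prop)
  have hint_lin : IntervalIntegrable (fun x => (1 - c * x) ^ 2 / 2) MeasureTheory.volume 0 h :=
    Continuous.intervalIntegrable (by fun_prop) _ _
  have hpointwise : ∀ x ∈ Set.Icc 0 h,
      (1 - c * x) ^ 2 / 2 - 1 / 16 ≤ (1 + a x - c * x) ^ 2 := by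
    rintro x ⟨hx0, hxh⟩
    have hax := hsmall (x := x) ⟨hx0, hxh.trans hle_one⟩ (by
      rw [Real.dist_eq, sub_zero, abs_of_nonneg hx0]
      linarith)
    rw [Real.dist_eq, ha0, sub_zero, abs_lt] at hax
    nlinarith [sq_nonneg (1 - c * x + 2 * a x)]
  calc 1 / 16 * h ≤ (∫ x in (0 : ℝ)..h, (1 - c * x) ^ 2) / 2 - 1 / 16 * h := by
        linarith [div_four_le_integral_one_sub_mul_sq hpos.le c]
    _ = ∫ x in (0 : ℝ)..h, ((1 - c * x) ^ 2 / 2 - 1 / 16) := by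
        rw [intervalIntegral.integral_sub hint_lin intervalIntegrable_const,
          intervalIntegral.integral_div, intervalIntegral.integral_const]
        simp only [sub_zero, smul_eq_mul]
        ring
    _ ≤ ∫ x in (0 : ℝ)..h, (1 + a x - c * x) ^ 2 :=
        intervalIntegral.integral_mono_on hpos.le (hint_lin.sub intervalIntegrable_const)
          hint hpointwise
end

section
/- Let r > 0 and c′ ∈ ℝ, and define z : ℝ² → ℝ² by z(x) = −(c′/r)·x for ‖x‖ ≤ r and z(x) = −c′·r·x/‖x‖² for ‖x‖ ≥ r. Then: (i) for every x with 0 < ‖x‖ < r, z is differentiable at x and the divergence of z at x (the trace of its Fréchet derivative) equals −2c′/r; (ii) for every x with ‖x‖ > r, z is differentiable at x and the divergence of z at x equals 0. -/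
/-- The divergence of a radial-type field `y ↦ f y • y` is `dim E * f x + f' x`. -/
theorem HasFDerivAt.differentiableAt_and_trace_fderiv_smul_self
    {E : Type*} [NormedAddCommGroup E] [NormedSpace ℝ E] [FiniteDimensional ℝ E]
    {f : E → ℝ} {f' : E →L[ℝ] ℝ} {z : E → E} {x : E}
    (hf : HasFDerivAt f f' x) (hz : z =ᶠ[nhds x] fun y => f y • y) :
    DifferentiableAt ℝ z x ∧
      LinearMap.trace ℝ E (fderiv ℝ z x).toLinearMap = Module.finrank ℝ E * f x + f' x := by
  have h : HasFDerivAt z (f x • ContinuousLinearMap.id ℝ E + f'.smulRight x) x :=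
    (hf.smul (hasFDerivAt_id x)).congr_of_eventuallyEq hz
  refine ⟨h.differentiableAt, ?_⟩
  have hL : (f x • ContinuousLinearMap.id ℝ E + f'.smulRight x).toLinearMap =
      f x • LinearMap.id + f'.toLinearMap.smulRight x := rfl
  rw [h.fderiv, hL, map_add, map_smul, LinearMap.trace_id, LinearMap.trace_smulRight,
    smul_eq_mul, mul_comm, ContinuousLinearMap.coe_coe]

theorem hasFDerivAt_neg_div_norm_sq {E : Type*} [NormedAddCommGroup E] [InnerProductSpace ℝ E]
    (a : ℝ) {x : E} (hx : x ≠ 0) :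
    HasFDerivAt (fun y : E => -(a / ‖y‖ ^ 2)) ((2 * a / ‖x‖ ^ 4) • innerSL ℝ x) x := by
  have hn : ‖x‖ ≠ 0 := norm_ne_zero_iff.mpr hx
  have h := ((hasDerivAt_inv (pow_ne_zero 2 hn)).const_mul (-a)).comp_hasFDerivAt x
    (hasStrictFDerivAt_norm_sq x).hasFDerivAt
  refine (h.congr_fderiv ?_).congr_of_eventuallyEq (.of_forall fun y => ?_)
  · ext v
    simp
    field_simp
  · simp [div_eq_mul_inv]

/-- The explicit dual vector field `z(x) = -(c'/r)x` for `‖x‖ ≤ r` and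
`z(x) = -c' r x/‖x‖²` for `‖x‖ ≥ r` is differentiable away from `0` and
`∂B_r`, with divergence (trace of the Fréchet derivative) `-2c'/r` inside the
disc and `0` outside. -/
theorem stmt_14 (r : ℝ) (hr : 0 < r) (c' : ℝ)
    (z : EuclideanSpace ℝ (Fin 2) → EuclideanSpace ℝ (Fin 2))
    (hz1 : ∀ x : EuclideanSpace ℝ (Fin 2), ‖x‖ ≤ r → z x = -(c' / r) • x)
    (hz2 : ∀ x : EuclideanSpace ℝ (Fin 2), r ≤ ‖x‖ →
      z x = -(c' * r / ‖x‖ ^ 2) • x) :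
    (∀ x : EuclideanSpace ℝ (Fin 2), 0 < ‖x‖ → ‖x‖ < r →
      DifferentiableAt ℝ z x ∧
        LinearMap.trace ℝ (EuclideanSpace ℝ (Fin 2)) (fderiv ℝ z x).toLinearMap =
          -(2 * c' / r)) ∧
    (∀ x : EuclideanSpace ℝ (Fin 2), r < ‖x‖ →
      DifferentiableAt ℝ z x ∧
        LinearMap.trace ℝ (EuclideanSpace ℝ (Fin 2)) (fderiv ℝ z x).toLinearMap =
          0) := by
  refine ⟨fun x _ hx => ?_, fun x hx => ?_⟩
  · have hz : z =ᶠ[nhds x] fun y => -(c' / r) • y := by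
      filter_upwards [continuous_norm.continuousAt.eventually_lt_const hx] with y hy
      exact hz1 y hy.le
    obtain ⟨hd, ht⟩ := (hasFDerivAt_const (-(c' / r)) x
      ).differentiableAt_and_trace_fderiv_smul_self hz
    refine ⟨hd, ht.trans ?_⟩
    simp
    ring
  · have hz : z =ᶠ[nhds x] fun y => -(c' * r / ‖y‖ ^ 2) • y := by
      filter_upwards [continuous_norm.continuousAt.eventually_const_lt hx] with y hy
      exact hz2 y hy.le
    have hn : ‖x‖ ≠ 0 := (hr.trans hx).ne'
    obtain ⟨hd, ht⟩ := (hasFDerivAt_neg_div_norm_sq (c' * r) (norm_ne_zero_iff.mp hn)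
      ).differentiableAt_and_trace_fderiv_smul_self hz
    refine ⟨hd, ht.trans ?_⟩
    simp
    field_simp
    ring
end

section
/- Let r > 0, c′ ∈ [0,1], and R ≥ r, and define z : ℝ² → ℝ² by z(x) = −(c′/r)·x for ‖x‖ ≤ r and z(x) = −c′·r·x/‖x‖² for ‖x‖ ≥ r (with z(0) = 0). Then z is continuous on ℝ², for every x ≠ 0 one has ‖z(x)‖ = c′·min(‖x‖/r, r/‖x‖), and for every x with ‖x‖ ≤ R one has ‖z(x)‖ ≤ 1 − (r/R²)·|‖x‖ − r|. -/
/-- The explicit dual vector field of the single-disc ROF problem is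
continuous, has norm `c' · min(‖x‖/r, r/‖x‖)`, and satisfies the structural
decay estimate `‖z(x)‖ ≤ 1 - (r/R²)·|‖x‖ - r|` on the ball of radius `R`. -/
theorem stmt_15 (r : ℝ) (hr : 0 < r) (c' : ℝ) (hc' : c' ∈ Set.Icc (0 : ℝ) 1)
    (R : ℝ) (hR : r ≤ R)
    (z : EuclideanSpace ℝ (Fin 2) → EuclideanSpace ℝ (Fin 2))
    (hz0 : z 0 = 0)
    (hz1 : ∀ x : EuclideanSpace ℝ (Fin 2), ‖x‖ ≤ r → z x = -(c' / r) • x)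
    (hz2 : ∀ x : EuclideanSpace ℝ (Fin 2), r ≤ ‖x‖ →
      z x = -(c' * r / ‖x‖ ^ 2) • x) :
    Continuous z ∧
    (∀ x : EuclideanSpace ℝ (Fin 2), x ≠ 0 →
      ‖z x‖ = c' * min (‖x‖ / r) (r / ‖x‖)) ∧
    (∀ x : EuclideanSpace ℝ (Fin 2), ‖x‖ ≤ R →
      ‖z x‖ ≤ 1 - r / R ^ 2 * |‖x‖ - r|) := by
  obtain ⟨hc0, hc1⟩ := hc'
  have hRpos : 0 < R := hr.trans_le hR
  have norm_inside : ∀ x, ‖x‖ ≤ r → ‖z x‖ = c' * (‖x‖ / r) := by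
    intro x hx
    rw [hz1 x hx, norm_smul, norm_neg, Real.norm_of_nonneg (by positivity)]
    ring
  have norm_outside : ∀ x, r ≤ ‖x‖ → ‖z x‖ = c' * (r / ‖x‖) := by
    intro x hx
    have hx0 : 0 < ‖x‖ := hr.trans_le hx
    rw [hz2 x hx, norm_smul, norm_neg, Real.norm_of_nonneg (by positivity)]
    field_simp
  refine ⟨?_, ?_, ?_⟩
  · have hz : z = fun x => -(c' * r / max ‖x‖ r ^ 2) • x := by
      funext x
      rcases le_total ‖x‖ r with hx | hx
      · rw [hz1 x hx, max_eq_right hx]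
        congr 2
        field_simp
      · rw [hz2 x hx, max_eq_left hx]
    rw [hz]
    have hne : ∀ x : EuclideanSpace ℝ (Fin 2), max ‖x‖ r ^ 2 ≠ 0 := fun x =>
      pow_ne_zero 2 (hr.trans_le (le_max_right _ _)).ne'
    fun_prop (disch := exact hne)
  · intro x hx
    have hx0 : 0 < ‖x‖ := norm_pos_iff.mpr hx
    rcases le_total ‖x‖ r with h | h
    · rw [norm_inside x h, min_eq_left]
      exact ((div_le_one hr).mpr h).trans ((one_le_div hx0).mpr h)
    · rw [norm_outside x h, min_eq_right]
      exact ((div_le_one hx0).mpr h).trans ((one_le_div hr).mpr h)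
  · intro x hxR
    rcases le_total ‖x‖ r with h | h
    · rw [norm_inside x h, abs_of_nonpos (sub_nonpos.mpr h)]
      have hcoef : r / R ^ 2 ≤ 1 / r := by
        rw [div_le_div_iff₀ (by positivity) hr]
        nlinarith
      calc c' * (‖x‖ / r) ≤ ‖x‖ / r := mul_le_of_le_one_left (by positivity) hc1
        _ = 1 - 1 / r * -(‖x‖ - r) := by field_simp; ring
        _ ≤ 1 - r / R ^ 2 * -(‖x‖ - r) :=
          sub_le_sub_left (mul_le_mul_of_nonneg_right hcoef (by linarith)) 1
    · have hx0 : 0 < ‖x‖ := hr.trans_le h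
      rw [norm_outside x h, abs_of_nonneg (sub_nonneg.mpr h)]
      have hcoef : r / R ^ 2 ≤ 1 / ‖x‖ := by
        rw [div_le_div_iff₀ (by positivity) hx0]
        nlinarith
      calc c' * (r / ‖x‖) ≤ r / ‖x‖ := mul_le_of_le_one_left (by positivity) hc1
        _ = 1 - 1 / ‖x‖ * (‖x‖ - r) := by field_simp; ring
        _ ≤ 1 - r / R ^ 2 * (‖x‖ - r) :=
          sub_le_sub_left (mul_le_mul_of_nonneg_right hcoef (by linarith)) 1
end

section
/- Let a < b be real numbers, let J ≥ 1 be an integer, and let a = x₀ < x₁ < … < x_J = b be a partition of [a,b]. Let v, w : ℝ → ℝ be functions such that w(x_j) = v(x_j) for all j = 0, …, J and, for each j = 1, …, J, the restriction of w to [x_{j−1}, x_j] is monotone (either nondecreasing or nonincreasing on that subinterval). Then the total variation of w on [a,b] is at most the total variation of v on [a,b]: eVariationOn w [a,b] ≤ eVariationOn v [a,b]. -/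
theorem eVariationOn_neg {α E : Type*} [LinearOrder α] [SeminormedAddCommGroup E]
    (f : α → E) (s : Set α) : eVariationOn (fun x => -f x) s = eVariationOn f s := by
  simp [eVariationOn, edist_neg_neg]

theorem MonotoneOn.eVariationOn_Icc_le_edist {α : Type*} [LinearOrder α] {f : α → ℝ} {c d : α}
    (hcd : c ≤ d) (hf : MonotoneOn f (Set.Icc c d)) :
    eVariationOn f (Set.Icc c d) ≤ edist (f d) (f c) := by
  have hc : c ∈ Set.Icc c d := Set.left_mem_Icc.2 hcd
  have hd : d ∈ Set.Icc c d := Set.right_mem_Icc.2 hcd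
  have h := hf.eVariationOn_eq hc hd
  rw [Set.inter_self] at h
  rw [h, edist_dist, Real.dist_eq]
  exact ENNReal.ofReal_le_ofReal (le_abs_self _)

theorem AntitoneOn.eVariationOn_Icc_le_edist {α : Type*} [LinearOrder α] {f : α → ℝ} {c d : α}
    (hcd : c ≤ d) (hf : AntitoneOn f (Set.Icc c d)) :
    eVariationOn f (Set.Icc c d) ≤ edist (f d) (f c) := by
  have h := MonotoneOn.eVariationOn_Icc_le_edist hcd hf.neg
  rwa [eVariationOn_neg, edist_neg_neg] at h

theorem eVariationOn_Icc_le_of_monotoneOn_or_antitoneOn {α : Type*} [LinearOrder α]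
    {v w : α → ℝ} {c d : α} (hcd : c ≤ d) (hc : w c = v c) (hd : w d = v d)
    (hw : MonotoneOn w (Set.Icc c d) ∨ AntitoneOn w (Set.Icc c d)) :
    eVariationOn w (Set.Icc c d) ≤ eVariationOn v (Set.Icc c d) :=
  calc
    eVariationOn w (Set.Icc c d) ≤ edist (w d) (w c) :=
      hw.elim (fun h => h.eVariationOn_Icc_le_edist hcd) fun h => h.eVariationOn_Icc_le_edist hcd
    _ = edist (v d) (v c) := by rw [hc, hd]
    _ ≤ eVariationOn v (Set.Icc c d) :=
      eVariationOn.edist_le v (Set.right_mem_Icc.2 hcd) (Set.left_mem_Icc.2 hcd)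

/-- Total-variation diminishing property of nodal interpolation in one
dimension: if `w` agrees with `v` at the nodes of a partition of `[a,b]` and is
monotone on each subinterval, then the total variation of `w` on `[a,b]` is at
most that of `v`. -/
theorem stmt_17 (a b : ℝ) (hab : a < b) (J : ℕ) (hJ : 1 ≤ J)
    (x : ℕ → ℝ) (hx0 : x 0 = a) (hxJ : x J = b)
    (hmono : ∀ j : ℕ, j < J → x j < x (j + 1))
    (v w : ℝ → ℝ)
    (hagree : ∀ j : ℕ, j ≤ J → w (x j) = v (x j))
    (hpiece : ∀ j : ℕ, j < J →
      MonotoneOn w (Set.Icc (x j) (x (j + 1))) ∨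
        AntitoneOn w (Set.Icc (x j) (x (j + 1)))) :
    eVariationOn w (Set.Icc a b) ≤ eVariationOn v (Set.Icc a b) := by
  have key : ∀ n ≤ J, x 0 ≤ x n ∧
      eVariationOn w (Set.Icc (x 0) (x n)) ≤ eVariationOn v (Set.Icc (x 0) (x n)) := by
    intro n
    induction n with
    | zero => simp [eVariationOn.subsingleton]
    | succ n ih =>
      intro hn
      obtain ⟨h0, hle⟩ := ih (Nat.le_of_succ_le hn)
      have hstep := (hmono n hn).le
      refine ⟨h0.trans hstep, ?_⟩
      have hsplit (f : ℝ → ℝ) :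
          eVariationOn f (Set.Icc (x 0) (x n)) + eVariationOn f (Set.Icc (x n) (x (n + 1))) =
            eVariationOn f (Set.Icc (x 0) (x (n + 1))) := by
        simpa using eVariationOn.Icc_add_Icc f h0 hstep (Set.mem_univ (x n))
      rw [← hsplit w, ← hsplit v]
      exact add_le_add hle <| eVariationOn_Icc_le_of_monotoneOn_or_antitoneOn hstep
        (hagree n (Nat.le_of_succ_le hn)) (hagree (n + 1) hn) (hpiece n hn)
  have h := (key J le_rfl).2
  rwa [hx0, hxJ] at h
end
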